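/- Let G be a finite simple graph on at least 3 vertices and t a positive integer such that for every partition P of V(G), |cr(P,G)| ≥ t(|P| - 1). Suppose G is edge-colored with exactly max_{P: |P|≥3}{ |E(P,G)| + t(|P|-2) } + 1 colors and contains no t pairwise edge-disjoint rainbow spanning trees. Then for every partition P of V(G) with |P| ≥ 3, we have |cr(P,G)| ≥ t(|P| - 1) + 1. -/

import Mathlib

open Finset
open scoped Classical

/-- The set of non-crossing edges of `G` with respect to a partition `P` of the
vertex set: edges whose two endpoints lie in the same part of `P`. -/
noncomputable def edgesNonCrossing {V : Type} [Fintype V] (G : SimpleGraph V)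
    (P : Finpartition (Finset.univ : Finset V)) : Finset (Sym2 V) :=
  G.edgeFinset.filter (fun e => ∃ p ∈ P.parts, ∀ v ∈ e, v ∈ p)

/-- The set of crossing edges of `G` with respect to a partition `P` of the
vertex set: edges whose endpoints lie in different parts of `P`. -/
noncomputable def edgesCrossing {V : Type} [Fintype V] (G : SimpleGraph V)
    (P : Finpartition (Finset.univ : Finset V)) : Finset (Sym2 V) :=
  G.edgeFinset.filter (fun e => ¬ ∃ p ∈ P.parts, ∀ v ∈ e, v ∈ p)

/-- `G`, edge-colored by `c`, contains `t` pairwise edge-disjoint rainbow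
spanning trees. -/
def HasRainbowSpanningTrees {V : Type} [Fintype V] (G : SimpleGraph V)
    (c : Sym2 V → ℕ) (t : ℕ) : Prop :=
  ∃ T : Fin t → SimpleGraph V,
    (∀ i, T i ≤ G) ∧ (∀ i, (T i).IsTree) ∧
    (∀ i, Set.InjOn c ((T i).edgeSet)) ∧
    (∀ i j, i ≠ j → Disjoint ((T i).edgeSet) ((T j).edgeSet))

/-- The anti-Ramsey number `r(G,t)`: the maximum number of colors in an
edge-coloring of `G` containing no `t` pairwise edge-disjoint rainbow spanning
trees. -/
noncomputable def antiRamsey {V : Type} [Fintype V] (G : SimpleGraph V) (t : ℕ) : ℕ :=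
  sSup {m | ∃ c : Sym2 V → ℕ, (G.edgeFinset.image c).card = m ∧
    ¬ HasRainbowSpanningTrees G c t}

/-- `max_{P : |P| ≥ 3} { |E(P,G)| + t(|P|-2) }`. -/
noncomputable def maxNonCross3 {V : Type} [Fintype V] (G : SimpleGraph V) (t : ℕ) : ℕ :=
  sSup {m | ∃ P : Finpartition (Finset.univ : Finset V), 3 ≤ P.parts.card ∧
    m = (edgesNonCrossing G P).card + t * (P.parts.card - 2)}

/-- `f_G(s)`: the maximum of `|E(P,G)|` over partitions of the vertex set into
exactly `s` parts. -/
noncomputable def fMax {V : Type} [Fintype V] (G : SimpleGraph V) (s : ℕ) : ℕ :=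
  sSup {m | ∃ P : Finpartition (Finset.univ : Finset V), P.parts.card = s ∧
    m = (edgesNonCrossing G P).card}

/-- The number of edges of `G` induced by a set `p` of vertices. -/
noncomputable def edgesWithin {V : Type} [Fintype V] (G : SimpleGraph V) (p : Finset V) : ℕ :=
  (G.edgeFinset.filter (fun e => ∀ v ∈ e, v ∈ p)).card

/-- One splitting step: remove a single vertex from a currently largest part
(measured by the number of non-crossing edges it induces) to form a new
singleton part. -/
def SplitStep {V : Type} [Fintype V] (G : SimpleGraph V)
    (P Q : Finpartition (Finset.univ : Finset V)) : Prop :=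
  ∃ p ∈ P.parts, (∀ q ∈ P.parts, edgesWithin G q ≤ edgesWithin G p) ∧
    ∃ v ∈ p, p.erase v ≠ ∅ ∧
      Q.parts = insert {v} (insert (p.erase v) (P.parts.erase p))

namespace RST
open SimpleGraph
set_option linter.unusedSectionVars false

variable {V : Type} [Fintype V]

/-- Reachability using a finite set of edges. -/
def R (S : Finset (Sym2 V)) (u v : V) : Prop := (fromEdgeSet (S : Set (Sym2 V))).Reachable u v

/-- Acyclicity of a finite set of edges. -/
def AC (S : Finset (Sym2 V)) : Prop := (fromEdgeSet (S : Set (Sym2 V))).IsAcyclic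

/-- Spanning tree. -/
def Tr (S : Finset (Sym2 V)) : Prop :=
  AC S ∧ S.card + 1 = Fintype.card V ∧ ∀ e ∈ S, ¬ e.IsDiag

lemma R.refl (S : Finset (Sym2 V)) (u : V) : R S u u := Reachable.refl _

lemma R.symm {S : Finset (Sym2 V)} {u v : V} (h : R S u v) : R S v u := Reachable.symm h

lemma R.trans {S : Finset (Sym2 V)} {u v w : V} (h : R S u v) (h' : R S v w) : R S u w :=
  Reachable.trans h h'

lemma R_of_mem {S : Finset (Sym2 V)} {u v : V} (h : s(u, v) ∈ S) : R S u v := by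
  by_cases huv : u = v
  · subst huv; exact R.refl _ _
  · exact Adj.reachable (by simp [h, huv])

/-- transfer of a walk -/
lemma R_of_walk {H : SimpleGraph V} {S : Finset (Sym2 V)} {u v : V} (p : H.Walk u v)
    (h : ∀ x y, s(x, y) ∈ p.edges → R S x y) : R S u v := by
  induction p with
  | nil => exact R.refl _ _
  | cons hadj p ih =>
    refine (h _ _ (by simp)).trans (ih fun x y hxy => h x y ?_)
    simp [hxy]

lemma R_mono' {S S' : Finset (Sym2 V)} {u v : V} (h : ∀ x y, s(x, y) ∈ S → R S' x y)
    (hR : R S u v) : R S' u v := by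
  obtain ⟨p⟩ := hR
  refine R_of_walk p fun x y hxy => h x y ?_
  have := p.edges_subset_edgeSet hxy
  simp at this
  exact this.1

lemma R_mono {S S' : Finset (Sym2 V)} (h : S ⊆ S') {u v : V} (hR : R S u v) : R S' u v :=
  R_mono' (fun _ _ hxy => R_of_mem (h hxy)) hR

lemma AC_mono {S S' : Finset (Sym2 V)} (h : S ⊆ S') (hS : AC S') : AC S :=
  IsAcyclic.anti (fromEdgeSet_mono (by exact_mod_cast h)) hS

lemma AC_insert {S : Finset (Sym2 V)} (hS : AC S) {u v : V} (h : ¬ R S u v) :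
    AC (insert s(u, v) S) := by
  have := IsAcyclic.sup_edge_of_not_reachable h hS
  unfold AC
  convert this using 1
  ext a b
  simp [edge, fromEdgeSet_adj]
  tauto

/-- The edges on a path of a forest are cut edges for its ends. -/
lemma not_R_erase {S : Finset (Sym2 V)} (hS : AC S) {u v : V}
    (p : (fromEdgeSet (S : Set (Sym2 V))).Walk u v) (hp : p.IsPath) {e : Sym2 V}
    (he : e ∈ p.edges) : ¬ R (S.erase e) u v := by
  intro hR
  obtain ⟨q, hq⟩ := hR.exists_isPath
  have hle : fromEdgeSet ((S.erase e : Finset (Sym2 V)) : Set (Sym2 V)) ≤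
    fromEdgeSet (S : Set (Sym2 V)) := fromEdgeSet_mono (by simp)
  have := (hS.subsingleton_path u v).elim ⟨p, hp⟩ ⟨q.mapLe hle, hq.mapLe hle⟩
  have h2 : p = q.mapLe hle := congrArg Subtype.val this
  rw [h2] at he
  rw [Walk.edges_mapLe_eq_edges] at he
  have := q.edges_subset_edgeSet he
  simp at this
  exact this.1.2 this.2

lemma AC_swap {S : Finset (Sym2 V)} (hS : AC S) {u v : V}
    (p : (fromEdgeSet (S : Set (Sym2 V))).Walk u v) (hp : p.IsPath) {e : Sym2 V}
    (he : e ∈ p.edges) : AC (insert s(u, v) (S.erase e)) :=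
  AC_insert (AC_mono (Finset.erase_subset _ _) hS) (not_R_erase hS p hp he)

lemma edgeFinset_from {S : Finset (Sym2 V)} (hS : ∀ e ∈ S, ¬ e.IsDiag) :
    (fromEdgeSet (S : Set (Sym2 V))).edgeFinset = S := by
  ext e
  simp
  exact fun h => hS e h

lemma AC_tree [Nonempty V] {S : Finset (Sym2 V)} (hS : AC S) (hd : ∀ e ∈ S, ¬ e.IsDiag) :
    ∃ T : Finset (Sym2 V), S ⊆ T ∧ (fromEdgeSet (T : Set (Sym2 V))).IsTree ∧
      T.card + 1 = Fintype.card V := by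
  obtain ⟨F, h1, -, h3⟩ := (connected_top (V := V)).exists_isTree_le_of_le_of_isAcyclic le_top hS
  refine ⟨F.edgeFinset, ?_, ?_, h3.card_edgeFinset⟩
  · rw [← edgeFinset_from hd]
    exact edgeFinset_mono h1
  · simpa using h3

lemma AC_card [Nonempty V] {S : Finset (Sym2 V)} (hS : AC S) (hd : ∀ e ∈ S, ¬ e.IsDiag) :
    S.card + 1 ≤ Fintype.card V := by
  obtain ⟨T, h1, -, h3⟩ := AC_tree hS hd
  have := Finset.card_le_card h1
  omega

lemma Tr.isTree [Nonempty V] {S : Finset (Sym2 V)} (h : Tr S) :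
    (fromEdgeSet (S : Set (Sym2 V))).IsTree := by
  obtain ⟨T, h1, h2, h3⟩ := AC_tree h.1 h.2.2
  have : S = T := Finset.eq_of_subset_of_card_le h1 (by have := h.2.1; omega)
  rwa [this]

lemma Tr.R [Nonempty V] {S : Finset (Sym2 V)} (h : Tr S) (u v : V) : R S u v :=
  h.isTree.connected.preconnected u v

/-- Symmetric exchange. -/
lemma exchange [Nonempty V] {S1 S2 : Finset (Sym2 V)} (h1 : Tr S1) (h2 : Tr S2)
    (hd : Disjoint S1 S2) {e : Sym2 V} (he : e ∈ S2) :
    ∃ e' ∈ S1, Tr (insert e (S1.erase e')) ∧ Tr (insert e' (S2.erase e)) := by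
  induction e with | h u v =>
  have huv : u ≠ v := fun h => h2.2.2 _ he (by simp [h])
  have hadj : (fromEdgeSet (S2 : Set (Sym2 V))).Adj u v := by simp [he, huv]
  have hnR : ¬ RST.R (S2.erase s(u, v)) u v :=
    not_R_erase h2.1 (Walk.cons hadj Walk.nil) (by simp [huv]) (by simp)
  obtain ⟨p, hp⟩ := (h1.R u v).exists_isPath
  have : ∃ x y, s(x, y) ∈ p.edges ∧ ¬ RST.R (S2.erase s(u, v)) x y := by
    by_contra! hcon
    exact hnR (R_of_walk p hcon)
  obtain ⟨x, y, hxy, hxyR⟩ := this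
  have hxyS : s(x, y) ∈ S1 := by
    have := p.edges_subset_edgeSet hxy
    simp at this
    exact this.1
  have hn1 : s(u, v) ∉ S1 := fun h => Finset.disjoint_left.mp hd h he
  have hn2 : s(x, y) ∉ S2 := fun h => Finset.disjoint_left.mp hd hxyS h
  refine ⟨s(x, y), hxyS, ⟨AC_swap h1.1 p hp hxy, ?_, ?_⟩,
    ⟨AC_insert (AC_mono (Finset.erase_subset _ _) h2.1) hxyR, ?_, ?_⟩⟩
  · rw [Finset.card_insert_of_notMem (by simp [hn1]), Finset.card_erase_add_one hxyS]
    exact h1.2.1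
  · intro e he'
    rcases Finset.mem_insert.mp he' with rfl | h
    · exact h2.2.2 _ he
    · exact h1.2.2 _ (Finset.mem_of_mem_erase h)
  · rw [Finset.card_insert_of_notMem (by simp [hn2]), Finset.card_erase_add_one he]
    exact h2.2.1
  · intro e he'
    rcases Finset.mem_insert.mp he' with rfl | h
    · exact h1.2.2 _ hxyS
    · exact h2.2.2 _ (Finset.mem_of_mem_erase h)

/-- A set of edges connecting all parts of a partition is large. -/
lemma card_le_of_parts [Nonempty V] {S : Finset (Sym2 V)}
    (P : Finpartition (Finset.univ : Finset V))
    (h : ∀ p ∈ P.parts, ∀ u ∈ p, ∀ v ∈ p, R S u v) :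
    Fintype.card V ≤ S.card + P.parts.card := by
  obtain ⟨v0⟩ := ‹Nonempty V›
  let p0 := P.part v0
  have hp0 : p0 ∈ P.parts := P.part_mem.mpr (Finset.mem_univ _)
  have hv0 : v0 ∈ p0 := P.mem_part (Finset.mem_univ _)
  have hne : ∀ p : Finset V, p ∈ P.parts → ∃ v, v ∈ p := fun p hp => P.nonempty_of_mem_parts hp
  let rep : Finset V → V := fun p => if hp : p ∈ P.parts then (hne p hp).choose else v0
  have hrep : ∀ p ∈ P.parts, rep p ∈ p := by
    intro p hp
    simp only [rep, hp, dif_pos]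
    exact (hne p hp).choose_spec
  let S' : Finset (Sym2 V) := S ∪ (P.parts.erase p0).image (fun p => s(v0, rep p))
  have hR : ∀ v, R S' v v0 := by
    intro v
    have hp : P.part v ∈ P.parts := P.part_mem.mpr (Finset.mem_univ _)
    have hv : v ∈ P.part v := P.mem_part (Finset.mem_univ _)
    by_cases hc : P.part v = p0
    · exact R_mono Finset.subset_union_left (h _ hp _ hv _ (hc ▸ hv0))
    · refine (R_mono Finset.subset_union_left (h _ hp _ hv _ (hrep _ hp))).trans (R.symm ?_)
      apply R_of_mem
      apply Finset.mem_union_right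
      exact Finset.mem_image.mpr ⟨_, Finset.mem_erase.mpr ⟨hc, hp⟩, rfl⟩
  have hconn : (fromEdgeSet (S' : Set (Sym2 V))).Connected := by
    have : Nonempty V := ⟨v0⟩
    exact ⟨fun u v => (hR u).trans (hR v).symm⟩
  have := hconn.card_vert_le_card_edgeSet_add_one
  have h1 : Nat.card (fromEdgeSet (S' : Set (Sym2 V))).edgeSet ≤ S'.card := by
    rw [Nat.card_coe_set_eq, ← Set.ncard_coe_finset]
    refine Set.ncard_le_ncard ?_ (Finset.finite_toSet _)
    rw [edgeSet_fromEdgeSet]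
    exact Set.sdiff_subset
  have h2 : S'.card ≤ S.card + (P.parts.erase p0).card :=
    (Finset.card_union_le _ _).trans (Nat.add_le_add_left Finset.card_image_le _)
  have h3 := Finset.card_erase_add_one hp0
  rw [Nat.card_eq_fintype_card] at this
  omega

section packing

variable {t : ℕ}

/-- A packing of forests. -/
def Valid (E : Finset (Sym2 V)) (F : Fin t → Finset (Sym2 V)) : Prop :=
  (∀ i, F i ⊆ E) ∧ (∀ i, AC (F i)) ∧ ∀ i j, i ≠ j → Disjoint (F i) (F j)

/-- One exchange step. -/
def Step (E : Finset (Sym2 V)) (F F' : Fin t → Finset (Sym2 V)) : Prop :=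
  Valid E F' ∧ ∃ i, ∃ e ∈ E, ∃ e' ∈ F i, (∀ j, e ∉ F j) ∧
    F' = Function.update F i (insert e ((F i).erase e'))

/-- Edges left uncovered by some reachable packing. -/
noncomputable def DD (E : Finset (Sym2 V)) (F0 : Fin t → Finset (Sym2 V)) : Finset (Sym2 V) :=
  E.filter (fun e => ∃ F, Relation.ReflTransGen (Step E) F0 F ∧ ∀ j, e ∉ F j)

lemma sum_update (F : Fin t → Finset (Sym2 V)) (i : Fin t) (A : Finset (Sym2 V)) :
    ∑ j, (Function.update F i A j).card + (F i).card = ∑ j, (F j).card + A.card := by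
  rw [← Finset.add_sum_erase _ _ (Finset.mem_univ i),
    ← Finset.add_sum_erase _ (fun j => (F j).card) (Finset.mem_univ i)]
  have : ∑ x ∈ Finset.univ.erase i, (Function.update F i A x).card
      = ∑ x ∈ Finset.univ.erase i, (F x).card := by
    refine Finset.sum_congr rfl fun x hx => ?_
    rw [Function.update_of_ne (Finset.ne_of_mem_erase hx)]
  rw [this]
  simp
  omega

lemma valid_update {E : Finset (Sym2 V)} {F : Fin t → Finset (Sym2 V)} (hF : Valid E F)
    {i : Fin t} {e : Sym2 V} {A : Finset (Sym2 V)} (hA : A ⊆ F i) (he : e ∈ E)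
    (hn : ∀ j, e ∉ F j) (hac : AC (insert e A)) :
    Valid E (Function.update F i (insert e A)) := by
  have key : ∀ j, j ≠ i → Disjoint (insert e A) (F j) := by
    intro j hj
    rw [Finset.disjoint_insert_left]
    exact ⟨hn j, Finset.disjoint_of_subset_left hA (hF.2.2 _ _ hj.symm)⟩
  refine ⟨fun j => ?_, fun j => ?_, fun j k hjk => ?_⟩
  · by_cases h : j = i
    · subst h
      simp only [Function.update_self]
      exact Finset.insert_subset he (hA.trans (hF.1 _))
    · rw [Function.update_of_ne h]; exact hF.1 j
  · by_cases h : j = i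
    · subst h
      simpa only [Function.update_self] using hac
    · rw [Function.update_of_ne h]; exact hF.2.1 j
  · by_cases h : j = i
    · subst h
      rw [Function.update_self, Function.update_of_ne hjk.symm]
      exact key k hjk.symm
    · rw [Function.update_of_ne h]
      by_cases h' : k = i
      · subst h'
        rw [Function.update_self]
        exact (key j h).symm
      · rw [Function.update_of_ne h']
        exact hF.2.2 _ _ hjk

lemma reach_inv {E : Finset (Sym2 V)} {F0 F : Fin t → Finset (Sym2 V)} (h0 : Valid E F0)
    (h : Relation.ReflTransGen (Step E) F0 F) :
    Valid E F ∧ ∑ i, (F i).card = ∑ i, (F0 i).card := by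
  induction h with
  | refl => exact ⟨h0, rfl⟩
  | @tail F _ _ hst ih =>
    obtain ⟨hv, i, e, he, e', he', hn, rfl⟩ := hst
    refine ⟨hv, ?_⟩
    rw [← ih.2]
    have := sum_update F i (insert e ((F i).erase e'))
    rw [Finset.card_insert_of_notMem (fun h => hn i (Finset.mem_of_mem_erase h)),
      Finset.card_erase_add_one he'] at this
    omega

lemma claim1 {E : Finset (Sym2 V)} {F0 F : Fin t → Finset (Sym2 V)} (h0 : Valid E F0)
    (hmax : ∀ F' : Fin t → Finset (Sym2 V), Valid E F' →
      ∑ i, (F' i).card ≤ ∑ i, (F0 i).card)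
    (h : Relation.ReflTransGen (Step E) F0 F) {u v : V} (he : s(u, v) ∈ E)
    (hn : ∀ j, s(u, v) ∉ F j) (i : Fin t) : R (F i ∩ DD E F0) u v := by
  obtain ⟨hv, hs⟩ := reach_inv h0 h
  have hR : R (F i) u v := by
    by_contra hcon
    have := hmax _ (valid_update hv (Finset.Subset.refl (F i)) he hn (AC_insert (hv.2.1 i) hcon))
    have h2 := sum_update F i (insert s(u, v) (F i))
    rw [Finset.card_insert_of_notMem (hn i)] at h2
    omega
  obtain ⟨p, hp⟩ := hR.exists_isPath
  refine R_of_walk p fun x y hxy => R_of_mem ?_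
  have hxyF : s(x, y) ∈ F i := by
    have := p.edges_subset_edgeSet hxy
    simp at this
    exact this.1
  refine Finset.mem_inter.mpr ⟨hxyF, Finset.mem_filter.mpr ⟨hv.1 i hxyF, ?_⟩⟩
  have hval := valid_update hv (Finset.erase_subset s(x, y) (F i)) he hn
    (AC_swap (hv.2.1 i) p hp hxy)
  refine ⟨_, h.tail ⟨hval, i, _, he, _, hxyF, hn, rfl⟩, fun j => ?_⟩
  by_cases hj : j = i
  · subst hj
    simp only [Function.update_self, Finset.mem_insert, Finset.mem_erase]
    rintro (h | h)
    · exact hn j (h ▸ hxyF)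
    · exact h.1 rfl
  · rw [Function.update_of_ne hj]
    exact fun h => Finset.disjoint_left.mp (hv.2.2 _ _ hj) h hxyF

lemma claim2 {E : Finset (Sym2 V)} {F0 F : Fin t → Finset (Sym2 V)} (h0 : Valid E F0)
    (hmax : ∀ F' : Fin t → Finset (Sym2 V), Valid E F' →
      ∑ i, (F' i).card ≤ ∑ i, (F0 i).card)
    (h : Relation.ReflTransGen (Step E) F0 F) (i : Fin t) {u v : V}
    (hR : R (F i ∩ DD E F0) u v) : R (F0 i ∩ DD E F0) u v := by
  induction h generalizing u v with
  | refl => exact hR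
  | @tail F F' hr hst ih =>
    apply ih
    refine R_mono' (fun x y hxy => ?_) hR
    obtain ⟨hv, k, e, he, e', he', hn, rfl⟩ := hst
    rw [Finset.mem_inter] at hxy
    by_cases hik : i = k
    · subst hik
      rw [Function.update_self, Finset.mem_insert] at hxy
      rcases hxy.1 with h | h
      · subst h
        exact claim1 h0 hmax hr he hn i
      · exact R_of_mem (Finset.mem_inter.mpr ⟨Finset.mem_of_mem_erase h, hxy.2⟩)
    · rw [Function.update_of_ne hik] at hxy
      exact R_of_mem (Finset.mem_inter.mpr hxy)

lemma claim3 {E : Finset (Sym2 V)} {F0 : Fin t → Finset (Sym2 V)} (h0 : Valid E F0)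
    (hmax : ∀ F' : Fin t → Finset (Sym2 V), Valid E F' →
      ∑ i, (F' i).card ≤ ∑ i, (F0 i).card) (i : Fin t) {u v : V}
    (hR : R (DD E F0) u v) : R (F0 i ∩ DD E F0) u v := by
  refine R_mono' (fun x y hxy => ?_) hR
  obtain ⟨he, F, hr, hn⟩ := Finset.mem_filter.mp hxy
  exact claim2 h0 hmax hr i (claim1 h0 hmax hr he hn i)

lemma exists_max (E : Finset (Sym2 V)) (t : ℕ) : ∃ F0 : Fin t → Finset (Sym2 V), Valid E F0 ∧
    ∀ F' : Fin t → Finset (Sym2 V), Valid E F' → ∑ i, (F' i).card ≤ ∑ i, (F0 i).card := by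
  have hne : ((Finset.univ : Finset (Fin t → Finset (Sym2 V))).filter (Valid E)).Nonempty := by
    refine ⟨fun _ => ∅, ?_⟩
    simp [Valid, AC]
  obtain ⟨F, hF, h⟩ := Finset.exists_max_image _ (fun F => ∑ i, (F i).card) hne
  exact ⟨F, (Finset.mem_filter.mp hF).2, fun F' hF' => h F' (by simp [hF'])⟩

/-- Nash-Williams, Tutte. -/
theorem packing [Nonempty V] (G : SimpleGraph V) (t : ℕ)
    (hcr : ∀ P : Finpartition (Finset.univ : Finset V),
      t * (P.parts.card - 1) ≤ (edgesCrossing G P).card) :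
    ∃ F : Fin t → Finset (Sym2 V), (∀ i, F i ⊆ G.edgeFinset) ∧ (∀ i, Tr (F i)) ∧
      ∀ i j, i ≠ j → Disjoint (F i) (F j) := by
  obtain ⟨F, hF, hmax⟩ := exists_max G.edgeFinset t
  have hdiag : ∀ i, ∀ e ∈ F i, ¬ e.IsDiag := fun i e he =>
    G.not_isDiag_of_mem_edgeFinset (hF.1 i he)
  refine ⟨F, hF.1, ?_, hF.2.2⟩
  have hle : ∀ i, (F i).card + 1 ≤ Fintype.card V := fun i => AC_card (hF.2.1 i) (hdiag i)
  by_contra hcon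
  push Not at hcon
  obtain ⟨i0, hi0⟩ := hcon
  have hlt : (F i0).card + 1 < Fintype.card V :=
    lt_of_le_of_ne (hle i0) fun h => hi0 ⟨hF.2.1 i0, h, hdiag i0⟩
  set D := DD G.edgeFinset F with hD
  let st : Setoid V := ⟨R D, R.refl D, R.symm, R.trans⟩
  let P : Finpartition (Finset.univ : Finset V) := Finpartition.ofSetoid st
  have hP : ∀ u v, (∃ p ∈ P.parts, u ∈ p ∧ v ∈ p) ↔ R D u v := by
    intro u v
    constructor
    · rintro ⟨p, hp, hu, hv⟩
      have h1 : P.part u = p := P.part_eq_of_mem hp hu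
      rw [← h1] at hv
      exact Finpartition.mem_part_ofSetoid_iff_rel.mp hv
    · intro h
      exact ⟨P.part u, P.part_mem.mpr (Finset.mem_univ _), P.mem_part (Finset.mem_univ _),
        Finpartition.mem_part_ofSetoid_iff_rel.mpr h⟩
  have hcard : ∀ i, Fintype.card V ≤ (F i ∩ D).card + P.parts.card := by
    intro i
    refine card_le_of_parts P fun p hp u hu v hv => ?_
    exact claim3 hF hmax i ((hP u v).mp ⟨p, hp, hu, hv⟩)
  have hsub : edgesCrossing G P ⊆ Finset.univ.biUnion (fun i => F i \ D) := by
    intro e he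
    obtain ⟨heG, hne⟩ := Finset.mem_filter.mp he
    have heD : e ∉ D := by
      intro h
      induction e with | h u v =>
      obtain ⟨p, hp, hu, hv⟩ := (hP u v).mpr (R_of_mem h)
      refine hne ⟨p, hp, fun w hw => ?_⟩
      rcases Sym2.mem_iff.mp hw with rfl | rfl <;> assumption
    have : ∃ i, e ∈ F i := by
      by_contra! hcon
      exact heD (Finset.mem_filter.mpr ⟨heG, F, Relation.ReflTransGen.refl, hcon⟩)
    obtain ⟨i, hi⟩ := this
    exact Finset.mem_biUnion.mpr ⟨i, Finset.mem_univ _, Finset.mem_sdiff.mpr ⟨hi, heD⟩⟩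
  have h1 := (Finset.card_le_card hsub).trans Finset.card_biUnion_le
  have h2 : ∀ i, (F i \ D).card ≤ P.parts.card - 1 := by
    intro i
    have := Finset.card_sdiff_add_card_inter (F i) D
    have := hcard i
    have := hle i
    omega
  have h3 : (F i0 \ D).card < P.parts.card - 1 := by
    have := Finset.card_sdiff_add_card_inter (F i0) D
    have := hcard i0
    omega
  have h4 : ∑ i, (F i \ D).card < ∑ _i : Fin t, (P.parts.card - 1) :=
    Finset.sum_lt_sum (fun i _ => h2 i) ⟨i0, Finset.mem_univ _, h3⟩
  have := hcr P
  simp at h4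
  omega

end packing

section rainbow

variable {ι : Type}

lemma swap_family {I : Finset ι} {F : ι → Finset (Sym2 V)}
    (hT : ∀ i ∈ I, Tr (F i)) (hd : ∀ i ∈ I, ∀ j ∈ I, i ≠ j → Disjoint (F i) (F j))
    {i j : ι} (hi : i ∈ I) (hj : j ∈ I) (hij : i ≠ j) {e e' : Sym2 V} (he : e ∈ F j)
    (he' : e' ∈ F i) (hA : Tr (insert e ((F i).erase e'))) (hB : Tr (insert e' ((F j).erase e))) :
    ∃ F2 : ι → Finset (Sym2 V), F2 i = insert e ((F i).erase e') ∧
      (∀ k ∈ I, Tr (F2 k)) ∧ (∀ k ∈ I, ∀ l ∈ I, k ≠ l → Disjoint (F2 k) (F2 l)) ∧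
      I.biUnion F2 ⊆ I.biUnion F := by
  -- membership in the new family is membership in the old one after transposing `e` and `e'`
  have hd' : ∀ x, ∀ k ∈ I, ∀ l ∈ I, x ∈ F k → x ∈ F l → k = l := by
    intro x k hk l hl h1 h2
    by_contra hne
    exact Finset.disjoint_left.mp (hd k hk l hl hne) h1 h2
  refine ⟨fun k => if k = i then insert e ((F i).erase e') else
    if k = j then insert e' ((F j).erase e) else F k, by simp, ?_, ?_, ?_⟩
  · intro k hk
    dsimp only
    split_ifs
    · exact hA
    · exact hB
    · exact hT k hk
  · intro k hk l hl hkl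
    rw [Finset.disjoint_left]
    intro x hx hx'
    dsimp only at hx hx'
    split_ifs at hx hx' <;> grind
  · intro x hx
    obtain ⟨k, hk, hx⟩ := Finset.mem_biUnion.mp hx
    rw [Finset.mem_biUnion]
    split_ifs at hx <;> grind

theorem rainbow [Nonempty V] (c : Sym2 V → ℕ) (n : ℕ) :
    ∀ (I : Finset ι) (F : ι → Finset (Sym2 V)) (U : Finset (Sym2 V)), I.card = n →
    (∀ i ∈ I, Tr (F i)) → (∀ i ∈ I, ∀ j ∈ I, i ≠ j → Disjoint (F i) (F j)) →
    I.biUnion F ⊆ U → U.card + 1 ≤ (U.image c).card + I.card →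
    ∃ F' : ι → Finset (Sym2 V), (∀ i ∈ I, F' i ⊆ U ∧ Tr (F' i) ∧
        Set.InjOn c (F' i : Set (Sym2 V))) ∧
      ∀ i ∈ I, ∀ j ∈ I, i ≠ j → Disjoint (F' i) (F' j) := by
  induction n with
  | zero =>
    intro I F U hI
    rw [Finset.card_eq_zero] at hI
    subst hI
    intros
    exact ⟨F, by simp, by simp⟩
  | succ n ih =>
    intro I F U hI hT hd hU hc
    have stepA : ∀ F : ι → Finset (Sym2 V), (∀ i ∈ I, Tr (F i)) →
        (∀ i ∈ I, ∀ j ∈ I, i ≠ j → Disjoint (F i) (F j)) → I.biUnion F ⊆ U →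
        ∀ i ∈ I, Set.InjOn c (F i : Set (Sym2 V)) → ∀ g ∈ F i, ∀ h ∈ U, h ∉ F i → c g = c h →
        ∃ F' : ι → Finset (Sym2 V), (∀ i ∈ I, F' i ⊆ U ∧ Tr (F' i) ∧
          Set.InjOn c (F' i : Set (Sym2 V))) ∧
          ∀ i ∈ I, ∀ j ∈ I, i ≠ j → Disjoint (F' i) (F' j) := by
      intro F hT hd hU i hi hinj g hg h hh hhn hgh
      have hFU : F i ⊆ U := (Finset.subset_biUnion_of_mem F hi).trans hU
      have hcard := Finset.card_sdiff_add_card_eq_card hFU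
      have hIe := Finset.card_erase_add_one hi
      have himg : U.image c ⊆ (U \ F i).image c ∪ ((F i).erase g).image c := by
        intro x hx
        obtain ⟨y, hy, rfl⟩ := Finset.mem_image.mp hx
        rw [Finset.mem_union, Finset.mem_image, Finset.mem_image]
        by_cases hyF : y ∈ F i
        · by_cases hyg : y = g
          · exact Or.inl ⟨h, Finset.mem_sdiff.mpr ⟨hh, hhn⟩, by rw [hyg, hgh]⟩
          · exact Or.inr ⟨y, Finset.mem_erase.mpr ⟨hyg, hyF⟩, rfl⟩
        · exact Or.inl ⟨y, Finset.mem_sdiff.mpr ⟨hy, hyF⟩, rfl⟩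
      have h1 := (Finset.card_le_card himg).trans (Finset.card_union_le _ _)
      have h2 : (((F i).erase g).image c).card ≤ ((F i).erase g).card := Finset.card_image_le
      have h3 := Finset.card_erase_add_one hg
      obtain ⟨F', hF', hF'd⟩ := ih (I.erase i) F (U \ F i) (by omega)
        (fun j hj => hT j (Finset.mem_of_mem_erase hj))
        (fun j hj k hk => hd j (Finset.mem_of_mem_erase hj) k (Finset.mem_of_mem_erase hk))
        (by
          intro x hx
          obtain ⟨j, hj, hx⟩ := Finset.mem_biUnion.mp hx
          obtain ⟨hji, hj⟩ := Finset.mem_erase.mp hj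
          exact Finset.mem_sdiff.mpr ⟨hU (Finset.mem_biUnion.mpr ⟨j, hj, hx⟩),
            Finset.disjoint_left.mp (hd j hj i hi hji) hx⟩)
        (by omega)
      have hdis : ∀ j ∈ I, j ≠ i → Disjoint (F' j) (F i) := fun j hj hji =>
        Finset.disjoint_of_subset_left (hF' j (Finset.mem_erase.mpr ⟨hji, hj⟩)).1
          Finset.sdiff_disjoint
      refine ⟨Function.update F' i (F i), fun j hj => ?_, fun j hj k hk hjk => ?_⟩
      · by_cases hji : j = i
        · subst hji
          rw [Function.update_self]
          exact ⟨hFU, hT j hj, hinj⟩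
        · rw [Function.update_of_ne hji]
          obtain ⟨a, b⟩ := hF' j (Finset.mem_erase.mpr ⟨hji, hj⟩)
          exact ⟨a.trans Finset.sdiff_subset, b⟩
      · by_cases hji : j = i
        · subst hji
          rw [Function.update_self, Function.update_of_ne hjk.symm]
          exact (hdis k hk hjk.symm).symm
        · rw [Function.update_of_ne hji]
          by_cases hki : k = i
          · subst hki
            rw [Function.update_self]
            exact hdis j hj hji
          · rw [Function.update_of_ne hki]
            exact hF'd j (Finset.mem_erase.mpr ⟨hji, hj⟩) k (Finset.mem_erase.mpr ⟨hki, hk⟩) hjk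
    by_cases hall : ∀ i ∈ I, Set.InjOn c (F i : Set (Sym2 V))
    · exact ⟨F, fun i hi => ⟨(Finset.subset_biUnion_of_mem F hi).trans hU, hT i hi, hall i hi⟩, hd⟩
    push Not at hall
    obtain ⟨j, hj, hjn⟩ := hall
    have hex : ∃ i ∈ I, Set.InjOn c (F i : Set (Sym2 V)) := by
      by_contra! hcon
      have h1 : ∀ i ∈ I, ((F i).image c).card + 1 ≤ (F i).card := by
        intro i hi
        refine Nat.succ_le_of_lt (lt_of_le_of_ne Finset.card_image_le fun h => ?_)
        exact hcon i hi (Finset.card_image_iff.mp h)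
      have h2 : (I.biUnion F).card = ∑ i ∈ I, (F i).card := Finset.card_biUnion hd
      have h3 : ((I.biUnion F).image c).card ≤ ∑ i ∈ I, ((F i).image c).card := by
        rw [Finset.biUnion_image]
        exact Finset.card_biUnion_le
      have h4 := Finset.sum_le_sum h1
      rw [Finset.sum_add_distrib] at h4
      have h5 := Finset.card_sdiff_add_card_eq_card hU
      have h6 : U.image c ⊆ (U \ I.biUnion F).image c ∪ (I.biUnion F).image c := by
        rw [← Finset.image_union, Finset.sdiff_union_of_subset hU]
      have h7 := (Finset.card_le_card h6).trans (Finset.card_union_le _ _)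
      have h8 : ((U \ I.biUnion F).image c).card ≤ (U \ I.biUnion F).card := Finset.card_image_le
      simp at h4
      omega
    obtain ⟨i, hi, hinj⟩ := hex
    by_cases hrep : ∃ g ∈ F i, ∃ h ∈ U, h ∉ F i ∧ c g = c h
    · obtain ⟨g, hg, h, hh, hhn, hgh⟩ := hrep
      exact stepA F hT hd hU i hi hinj g hg h hh hhn hgh
    push Not at hrep
    have hij : i ≠ j := fun h => hjn (h ▸ hinj)
    simp only [Set.InjOn, not_forall] at hjn
    obtain ⟨e, he, f, hf, hef, hne⟩ := hjn
    rw [Finset.mem_coe] at he hf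
    have hjU : ∀ x ∈ F j, x ∈ U := fun x hx => hU (Finset.mem_biUnion.mpr ⟨j, hj, hx⟩)
    have hji : ∀ x ∈ F j, x ∉ F i := fun x hx =>
      Finset.disjoint_left.mp (hd j hj i hi hij.symm) hx
    obtain ⟨e', he', hA, hB⟩ := exchange (hT i hi) (hT j hj) (hd i hi j hj hij) he
    obtain ⟨F2, h1, h2, h3, h4⟩ := swap_family hT hd hi hj hij he he' hA hB
    refine stepA F2 h2 h3 (h4.trans hU) i hi ?_ e (by simp [h1]) f (hjU f hf) ?_ hef
    · rw [h1]
      intro x hx y hy hxy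
      have hce : ∀ x ∈ F i, c x ≠ c e := fun x hx => hrep x hx e (hjU e he) (hji e he)
      simp only [Finset.mem_coe, Finset.mem_insert, Finset.mem_erase] at hx hy
      rcases hx with rfl | hx <;> rcases hy with rfl | hy
      · rfl
      · exact absurd hxy.symm (hce y hy.2)
      · exact absurd hxy (hce x hx.2)
      · exact hinj hx.2 hy.2 hxy
    · rw [h1]
      simp only [Finset.mem_insert, Finset.mem_erase]
      rintro (h | h)
      · exact hne h.symm
      · exact hji f hf h.2

end rainbow

end RST

/-- If every partition `P` of `V(G)` satisfies
`|cr(P,G)| ≥ t(|P|-1)`, and `G` is edge-colored with exactly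
`max_{P : |P| ≥ 3}{|E(P,G)| + t(|P|-2)} + 1` colors with no `t` pairwise
edge-disjoint rainbow spanning trees, then every partition `P` with `|P| ≥ 3`
satisfies `|cr(P,G)| ≥ t(|P|-1) + 1`. -/
theorem stmt12 {V : Type} [Fintype V] (G : SimpleGraph V) (t : ℕ) (ht : 0 < t)
    (hV : 3 ≤ Fintype.card V)
    (hcr : ∀ P : Finpartition (Finset.univ : Finset V),
      t * (P.parts.card - 1) ≤ (edgesCrossing G P).card)
    (c : Sym2 V → ℕ)
    (hc : (G.edgeFinset.image c).card = maxNonCross3 G t + 1)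
    (hno : ¬ HasRainbowSpanningTrees G c t) :
    ∀ P : Finpartition (Finset.univ : Finset V), 3 ≤ P.parts.card →
      t * (P.parts.card - 1) + 1 ≤ (edgesCrossing G P).card := by
  intro P hP
  by_contra hlt
  have : Nonempty V := Fintype.card_pos_iff.mp (by omega)
  obtain ⟨F, hFE, hT, hd⟩ := RST.packing G t hcr
  have hsum : (edgesNonCrossing G P).card + (edgesCrossing G P).card = G.edgeFinset.card :=
    Finset.card_filter_add_card_filter_not _
  have hmax : (edgesNonCrossing G P).card + t * (P.parts.card - 2) ≤ maxNonCross3 G t := by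
    apply le_csSup
    · refine ⟨G.edgeFinset.card + t * (Fintype.card V - 2), ?_⟩
      rintro m ⟨Q, -, rfl⟩
      have h1 : (edgesNonCrossing G Q).card ≤ G.edgeFinset.card :=
        Finset.card_le_card (Finset.filter_subset _ _)
      have h2 : Q.parts.card ≤ Fintype.card V := Q.card_parts_le_card
      exact Nat.add_le_add h1 (Nat.mul_le_mul_left _ (Nat.sub_le_sub_right h2 2))
    · exact ⟨P, hP, rfl⟩
  have hmul : t * (P.parts.card - 1) = t * (P.parts.card - 2) + t := by
    rw [← Nat.mul_succ]
    congr 1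
    omega
  obtain ⟨F', h1, h2⟩ := RST.rainbow c t (Finset.univ : Finset (Fin t)) F G.edgeFinset (by simp)
    (fun i _ => hT i) (fun i _ j _ => hd i j)
    (Finset.biUnion_subset.mpr fun i _ => hFE i)
    (by rw [Finset.card_univ, Fintype.card_fin]; omega)
  have hes : ∀ i, (SimpleGraph.fromEdgeSet (F' i : Set (Sym2 V))).edgeSet = F' i := by
    intro i
    rw [← SimpleGraph.coe_edgeFinset, RST.edgeFinset_from (h1 i (Finset.mem_univ _)).2.1.2.2]
  refine hno ⟨fun i => SimpleGraph.fromEdgeSet (F' i : Set (Sym2 V)), fun i => ?_, fun i => ?_,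
    fun i => ?_, fun i j hij => ?_⟩
  · rw [← SimpleGraph.edgeSet_subset_edgeSet, hes]
    intro e he
    exact SimpleGraph.mem_edgeFinset.mp ((h1 i (Finset.mem_univ _)).1 he)
  · exact (h1 i (Finset.mem_univ _)).2.1.isTree
  · rw [hes]
    exact (h1 i (Finset.mem_univ _)).2.2
  · rw [hes, hes]
    exact_mod_cast h2 i (Finset.mem_univ _) j (Finset.mem_univ _) hij
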